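/- arXiv:2409.08819 — 3 statements merged into one kernel-verified Lean document; each statement's English description precedes it below -/
import Mathlib

section
/- Let n, m be positive integers with n ≥ m and let ε be a real number with 0 < ε < 1 such that ((n + m)/n)·(1/((1 − ε)·log m)) + m^{−ε} ≤ ε. Then R(Q_m, Q_n) ≤ n·(m − (1 − ε)²·log m). In particular, for all integers m, n with 2^25 ≤ m ≤ n, R(Q_m, Q_n) ≤ n·(m − (1 − 2/√(log m))·log m). -/
open Finset

/-- The poset Ramsey number `R(P,Q)`: the least `N` such that every blue/red coloring of the
Boolean lattice `Q_N` (subsets of `Fin N` ordered by inclusion, colors as `Bool` with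
`true` = blue, `false` = red) contains a blue induced copy of `P` or a red induced copy of `Q`,
where an induced copy is the image of an order embedding. -/
noncomputable def posetRamsey (P : Type*) (Q : Type*) [PartialOrder P] [PartialOrder Q] : ℕ :=
  sInf {N : ℕ | ∀ c : Finset (Fin N) → Bool,
    (∃ e : P ↪o Finset (Fin N), ∀ p, c (e p) = true) ∨
    (∃ e : Q ↪o Finset (Fin N), ∀ q, c (e q) = false)}

/-- `s` contains an induced copy of the Boolean lattice of dimension `n`. -/
def ContainsCube {α : Type*} (n : ℕ) (s : Set (Finset α)) : Prop :=
  ∃ e : Finset (Fin n) ↪o Finset α, ∀ a, e a ∈ s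

section Cubes

variable {α : Type*} [DecidableEq α]

/-- A monotone map on the subsets of `X` that preserves the trace on `X` yields a cube. -/
lemma containsCube_of_trace {s : Set (Finset α)} {n : ℕ} {X : Finset α} (hX : X.card = n)
    (φ : Finset α → Finset α) (hmono : ∀ A B, A ⊆ B → B ⊆ X → φ A ⊆ φ B)
    (htrace : ∀ A, A ⊆ X → φ A ∩ X = A) (hs : ∀ A, A ⊆ X → φ A ∈ s) :
    ContainsCube n s := by
  let f : Fin n ↪ α := (X.equivFinOfCardEq hX).symm.toEmbedding.trans (Function.Embedding.subtype _)
  have hf : ∀ A : Finset (Fin n), A.map f ⊆ X := by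
    intro A x hx
    obtain ⟨i, -, rfl⟩ := Finset.mem_map.1 hx
    exact ((X.equivFinOfCardEq hX).symm i).2
  refine ⟨OrderEmbedding.ofMapLEIff (fun A => φ (A.map f)) fun A B => ⟨fun h => ?_, fun h => ?_⟩,
    fun A => hs _ (hf A)⟩
  · have h' : φ (A.map f) ∩ X ⊆ φ (B.map f) ∩ X := Finset.inter_subset_inter_right h
    rw [htrace _ (hf A), htrace _ (hf B)] at h'
    exact Finset.map_subset_map.1 h'
  · exact hmono _ _ (Finset.map_subset_map.2 h) (hf B)

/-- If `s` contains no cube of dimension `m`, every interval of dimension at least `m` contains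
an element outside of `s`. -/
lemma exists_notMem_of_not_containsCube {s : Set (Finset α)} {m : ℕ} (h : ¬ ContainsCube m s)
    {W B : Finset α} (hWB : Disjoint W B) (hB : m ≤ B.card) :
    ∃ V, W ⊆ V ∧ V ⊆ W ∪ B ∧ V ∉ s := by
  by_contra! hc
  obtain ⟨B', hB', hcard⟩ := Finset.exists_subset_card_eq hB
  refine h (containsCube_of_trace hcard (fun A => W ∪ A) (fun A C hAC _ => ?_) (fun A hA => ?_)
    fun A hA => hc _ Finset.subset_union_left ?_)
  · exact Finset.union_subset_union_right hAC
  · have : W ∩ B' = ∅ := Finset.disjoint_iff_inter_eq_empty.1 (hWB.mono_right hB')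
    rw [Finset.union_inter_distrib_right, this, Finset.empty_union, Finset.inter_eq_left.2 hA]
  · exact Finset.union_subset_union_right (hA.trans hB')

/-- A cube with one element in each of a sequence of stacked intervals. -/
lemma containsCube_of_layers {s : Set (Finset α)} {n : ℕ} {X : Finset α} (hX : X.card = n)
    (lo hi : ℕ → Finset α) (hstack : ∀ i j, i < j → hi i ⊆ lo j) (hdisj : ∀ i, Disjoint (hi i) X)
    (hs : ∀ A, A ⊆ X → ∃ V ∈ s, A ∪ lo A.card ⊆ V ∧ V ⊆ A ∪ hi A.card) :
    ContainsCube n s := by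
  classical
  choose! φ hφs hlo hhi using hs
  refine containsCube_of_trace hX φ (fun A B hAB hB => ?_) (fun A hA => ?_) hφs
  · rcases hAB.eq_or_ssubset with rfl | hss
    · exact subset_rfl
    · refine (hhi A (hAB.trans hB)).trans (subset_trans ?_ (hlo B hB))
      exact Finset.union_subset_union hAB (hstack _ _ (Finset.card_lt_card hss))
  · refine Finset.Subset.antisymm (fun x hx => ?_) (Finset.subset_inter ?_ hA)
    · obtain ⟨hx1, hx2⟩ := Finset.mem_inter.1 hx
      rcases Finset.mem_union.1 (hhi A hA hx1) with h | h
      · exact h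
      · exact absurd hx2 (Finset.disjoint_left.1 (hdisj _) h)
    · exact Finset.subset_union_left.trans (hlo A hA)

/-- A set of size at least `m * r` contains a chain of sets with `r` steps of size `m`. -/
lemma exists_blocks (Y : Finset α) (m r : ℕ) (h : m * r ≤ Y.card) :
    ∃ b : ℕ → Finset α, Monotone b ∧ b 0 = ∅ ∧ (∀ i, b i ⊆ Y) ∧
      ∀ i < r, (b (i + 1) \ b i).card = m := by
  suffices H : ∃ b : ℕ → Finset α, Monotone b ∧ (∀ i, b i ⊆ Y) ∧ ∀ i ≤ r, (b i).card = m * i by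
    obtain ⟨b, hb, hY, hc⟩ := H
    refine ⟨b, hb, by simpa using hc 0 (Nat.zero_le _), hY, fun i hi => ?_⟩
    rw [Finset.card_sdiff_of_subset (hb i.le_succ), hc _ hi, hc _ hi.le, Nat.mul_succ,
      Nat.add_sub_cancel_left]
  induction r with
  | zero => exact ⟨fun _ => ∅, monotone_const, by simp, by simp⟩
  | succ r ih =>
    obtain ⟨b, hb, hY, hc⟩ := ih ((Nat.mul_le_mul_left m (Nat.le_succ r)).trans h)
    obtain ⟨b', hb', hY', hc'⟩ := Finset.exists_subsuperset_card_eq (hY r)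
      (by rw [hc r le_rfl]; exact Nat.mul_le_mul_left m (Nat.le_succ r)) h
    refine ⟨fun i => if i ≤ r then b i else b', fun i j hij => ?_, fun i => ?_, fun i hi => ?_⟩
    · by_cases hj : j ≤ r
      · simpa [hj, hij.trans hj] using hb hij
      · by_cases hi : i ≤ r
        · simpa [hj, hi] using (hb hi).trans hb'
        · simp [hj, hi]
    · dsimp only
      split_ifs
      exacts [hY i, hY']
    · by_cases hir : i ≤ r
      · simpa [hir] using hc i hir
      · obtain rfl : i = r + 1 := by omega
        simpa using hc'

/-- Local recursion on finite sets: each piece is chosen depending on the union of the pieces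
of the proper subsets. -/
lemma exists_local_pieces (F : Finset α → Finset α → Finset α) :
    ∃ g : Finset α → Finset α, ∀ A, g A = F A (A.ssubsets.biUnion g) := by
  classical
  let G : ∀ A : Finset α, (∀ B, B ⊂ A → Finset α) → Finset α := fun A rec =>
    F A (A.ssubsets.attach.biUnion fun B => rec B.1 (Finset.mem_ssubsets.1 B.2))
  have hwf : WellFounded fun A B : Finset α => A ⊂ B := Finset.isWellFounded_ssubset.wf
  refine ⟨hwf.fix G, fun A => ?_⟩
  rw [hwf.fix_eq]
  change F A (A.ssubsets.attach.biUnion fun B => hwf.fix G B.1) = _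
  congr 1
  ext x
  simp

variable [Fintype α]

/-- A red cube whose bottom layers lie in a given red window. -/
lemma containsCube_of_bottom {s : Set (Finset α)} {m n t : ℕ} {U X : Finset α}
    (hX : X.card = n) (hUX : Disjoint U X) (hcard : n + U.card + m * (n - t) ≤ Fintype.card α)
    (hs : ¬ ContainsCube m sᶜ) (hlow : ∀ S, S ⊆ X → S.card ≤ t → U ∪ S ∈ s) :
    ContainsCube n s := by
  have hY : m * (n - t) ≤ ((U ∪ X)ᶜ).card := by
    rw [Finset.card_compl, Finset.card_union_of_disjoint hUX]
    omega
  obtain ⟨b, hb, hb0, hbY, hbm⟩ := exists_blocks _ m (n - t) hY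
  have hbUX : ∀ i, Disjoint (b i) (U ∪ X) := fun i =>
    Finset.subset_compl_iff_disjoint_right.1 (hbY i)
  refine containsCube_of_layers hX (fun i => U ∪ b (i - t - 1)) (fun i => U ∪ b (i - t))
    (fun i j hij => Finset.union_subset_union_right (hb (by omega))) (fun i => ?_) fun A hA => ?_
  · exact Finset.disjoint_union_left.2 ⟨hUX, (hbUX _).mono_right Finset.subset_union_right⟩
  · have hAn := Finset.card_le_card hA
    rcases le_or_gt A.card t with hAt | hAt
    · refine ⟨U ∪ A, hlow A hA hAt, ?_, ?_⟩ <;>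
        simp [Nat.sub_eq_zero_of_le hAt, hb0, Finset.union_comm]
    · have hstep : A.card - t - 1 + 1 = A.card - t := by omega
      have hc := hbm (A.card - t - 1) (by omega)
      rw [hstep] at hc
      obtain ⟨V, h1, h2, h3⟩ := exists_notMem_of_not_containsCube hs
        (W := A ∪ (U ∪ b (A.card - t - 1))) (B := b (A.card - t) \ b (A.card - t - 1)) (by
          rw [Finset.disjoint_left]
          intro x hx hx'
          obtain ⟨hx1, hx2⟩ := Finset.mem_sdiff.1 hx'
          have := Finset.disjoint_left.1 (hbUX _) hx1
          simp only [Finset.mem_union, not_or] at this hx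
          rcases hx with hx | hx | hx
          exacts [this.2 (hA hx), this.1 hx, hx2 hx]) hc.ge
      refine ⟨V, by simpa using h3, h1, h2.trans ?_⟩
      have := hb (show A.card - t - 1 ≤ A.card - t by omega)
      intro x hx
      have hx' := @this x
      simp only [Finset.mem_union, Finset.mem_sdiff] at hx ⊢
      tauto

/-- A red cube whose top layers are given by the red sets of small complement. -/
lemma containsCube_of_top {s : Set (Finset α)} {m n t : ℕ}
    (hcard : n + m * (n - t) ≤ Fintype.card α)
    (hs : ¬ ContainsCube m sᶜ) (htop : ∀ V : Finset α, Vᶜ.card ≤ t → V ∈ s) :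
    ContainsCube n s := by
  obtain ⟨X, -, hX⟩ := Finset.exists_subset_card_eq (s := (Finset.univ : Finset α)) (n := n)
    (by rw [Finset.card_univ]; omega)
  have hY : m * (n - t) ≤ (Xᶜ).card := by
    rw [Finset.card_compl]
    omega
  obtain ⟨b, hb, -, hbY, hbm⟩ := exists_blocks _ m (n - t) hY
  refine containsCube_of_layers hX (fun i => if i < n - t then b i else Xᶜ)
    (fun i => if i < n - t then b (i + 1) else Xᶜ) (fun i j hij => ?_) (fun i => ?_) fun A hA => ?_
  · by_cases hj : j < n - t
    · simpa [hj, hij.trans hj] using hb hij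
    · simp only [hj, if_false]
      split_ifs
      exacts [hbY _, subset_rfl]
  · refine Finset.subset_compl_iff_disjoint_right.1 ?_
    split_ifs
    exacts [hbY _, subset_rfl]
  · have hAn := Finset.card_le_card hA
    by_cases hAt : A.card < n - t
    · simp only [hAt, if_true]
      obtain ⟨V, h1, h2, h3⟩ := exists_notMem_of_not_containsCube hs
        (W := A ∪ b A.card) (B := b (A.card + 1) \ b A.card) (by
          rw [Finset.disjoint_left]
          intro x hx hx'
          obtain ⟨hx1, hx2⟩ := Finset.mem_sdiff.1 hx'
          rcases Finset.mem_union.1 hx with hx | hx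
          exacts [Finset.mem_compl.1 (hbY _ hx1) (hA hx), hx2 hx]) (hbm _ hAt).ge
      refine ⟨V, by simpa using h3, h1, h2.trans ?_⟩
      have := hb (Nat.le_succ A.card)
      intro x hx
      have hx' := @this x
      simp only [Finset.mem_union, Finset.mem_sdiff] at hx ⊢
      tauto
    · simp only [hAt, if_false]
      refine ⟨A ∪ Xᶜ, htop _ ?_, subset_rfl, subset_rfl⟩
      have : (A ∪ Xᶜ)ᶜ = X \ A := by
        ext x
        simp [and_comm]
      rw [this, Finset.card_sdiff_of_subset hA]
      omega

/-- Ramsey bound with the bottom `k + 1` layers and the top element of the blue cube embedded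
economically. -/
lemma containsCube_or_containsCube_compl (s : Set (Finset α)) {m n k t : ℕ} (hkm : k + 1 ≤ m)
    (h1 : m + n + 2 ^ k * t + n * (m - (k + 1)) ≤ Fintype.card α)
    (h2 : n + (2 ^ k - 1) * t + k + m * (n - t) ≤ Fintype.card α) :
    ContainsCube m s ∨ ContainsCube n sᶜ := by
  classical
  by_contra! hcon
  obtain ⟨hblue, hred⟩ := hcon
  have hblue' : ¬ ContainsCube m sᶜᶜ := by rwa [compl_compl]
  -- the image of the top element
  obtain ⟨T, hTt, hTs⟩ : ∃ T : Finset α, Tᶜ.card ≤ t ∧ T ∈ s := by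
    by_contra! hc
    exact hred (containsCube_of_top (by omega) hblue' hc)
  have hTcard : m + (n + (2 ^ k - 1) * t) + n * (m - (k + 1)) ≤ T.card := by
    have hT := Finset.card_add_card_compl T
    have hpow : 2 ^ k * t = (2 ^ k - 1) * t + t := by
      rw [Nat.sub_mul, one_mul, Nat.sub_add_cancel]
      exact Nat.le_mul_of_pos_left t (by positivity)
    omega
  obtain ⟨X, hXT, hX⟩ := Finset.exists_subset_card_eq (s := T) (n := m) (by omega)
  obtain ⟨P, hPT, hP⟩ := Finset.exists_subset_card_eq (s := T \ X) (n := n + (2 ^ k - 1) * t)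
    (by rw [Finset.card_sdiff_of_subset hXT]; omega)
  have hXP : Disjoint X P := (Finset.disjoint_sdiff (s := X) (t := T)).mono_right hPT
  have hPT' : P ⊆ T := hPT.trans Finset.sdiff_subset
  obtain ⟨b, hb, -, hbY, hbn⟩ := exists_blocks (T \ (X ∪ P)) n (m - (k + 1)) (by
    rw [Finset.card_sdiff_of_subset (Finset.union_subset hXT hPT'),
      Finset.card_union_of_disjoint hXP]
    omega)
  have hbXP : ∀ i, Disjoint (b i) (X ∪ P) := fun i =>
    (Finset.sdiff_disjoint (s := X ∪ P) (t := T)).mono_left (hbY i)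
  have hbT : ∀ i, b i ⊆ T := fun i => (hbY i).trans Finset.sdiff_subset
  -- the bottom layers
  have hstep : ∀ A u : Finset α, ∃ g : Finset α, g ⊆ P ∧ g.card ≤ t ∧
      (A ⊆ X → A.card ≤ k → u ⊆ P → u.card ≤ (2 ^ k - 1) * t → A ∪ (u ∪ g) ∈ s) := by
    intro A u
    by_contra! hc
    obtain ⟨hA, hAk, hu, huk, -⟩ := hc ∅ (by simp) (by simp)
    obtain ⟨W, hW, hWn⟩ := Finset.exists_subset_card_eq (s := P \ u) (n := n)
      (by rw [Finset.card_sdiff_of_subset hu]; omega)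
    have hWP : W ⊆ P := hW.trans Finset.sdiff_subset
    have hAu := Finset.card_union_le A u
    refine hred (containsCube_of_bottom (U := A ∪ u) (t := t) hWn ?_ (by omega) hblue'
      fun S hS hSt => ?_)
    · exact Finset.disjoint_union_left.2 ⟨hXP.mono hA hWP,
        (Finset.disjoint_sdiff (s := u) (t := P)).mono_right hW⟩
    · rw [Finset.union_assoc]
      exact (hc S (hS.trans hWP) hSt).2.2.2.2
  choose F hFP hFt hFs using hstep
  obtain ⟨g, hg⟩ := exists_local_pieces F
  have hgP : ∀ A, g A ⊆ P := fun A => by rw [hg]; exact hFP _ _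
  have hgt : ∀ A, (g A).card ≤ t := fun A => by rw [hg]; exact hFt _ _
  let ψ : Finset α → Finset α := fun A => A.powerset.biUnion g
  have hψ : ∀ A, ψ A = A.ssubsets.biUnion g ∪ g A := by
    intro A
    ext x
    simp only [ψ, Finset.mem_union, Finset.mem_biUnion, Finset.mem_powerset, Finset.mem_ssubsets]
    constructor
    · rintro ⟨B, hB, hx⟩
      rcases hB.eq_or_ssubset with rfl | h
      exacts [Or.inr hx, Or.inl ⟨B, h, hx⟩]
    · rintro (⟨B, hB, hx⟩ | hx)
      exacts [⟨B, hB.subset, hx⟩, ⟨A, subset_rfl, hx⟩]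
  have hψP : ∀ A, ψ A ⊆ P := fun A => Finset.biUnion_subset.2 fun B _ => hgP B
  have hψmono : ∀ A B, A ⊆ B → ψ A ⊆ ψ B := fun A B hAB =>
    Finset.biUnion_subset_biUnion_of_subset_left g (Finset.powerset_mono.2 hAB)
  have hlow : ∀ A, A ⊆ X → A.card ≤ k → A ∪ ψ A ∈ s := by
    intro A hA hAk
    rw [hψ, hg A]
    refine hFs _ _ hA hAk (Finset.biUnion_subset.2 fun B _ => hgP B)
      ((Finset.card_biUnion_le_card_mul _ _ t fun B _ => hgt B).trans ?_)
    rw [Finset.ssubsets, Finset.card_erase_of_mem (Finset.mem_powerset_self A),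
      Finset.card_powerset]
    exact Nat.mul_le_mul_right t (Nat.sub_le_sub_right (Nat.pow_le_pow_right two_pos hAk) 1)
  -- the upper layers
  have hhigh : ∀ A, A ⊆ X → k < A.card → A.card < m →
      ∃ V ∈ s, A ∪ (P ∪ b (A.card - (k + 1))) ⊆ V ∧ V ⊆ A ∪ (P ∪ b (A.card - k)) := by
    intro A hA hkA hAm
    have hc := hbn (A.card - (k + 1)) (by omega)
    rw [show A.card - (k + 1) + 1 = A.card - k by omega] at hc
    obtain ⟨V, h1, h2, h3⟩ := exists_notMem_of_not_containsCube hred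
      (W := A ∪ (P ∪ b (A.card - (k + 1)))) (B := b (A.card - k) \ b (A.card - (k + 1))) (by
        rw [Finset.disjoint_left]
        intro x hx hx'
        obtain ⟨hx1, hx2⟩ := Finset.mem_sdiff.1 hx'
        have := Finset.disjoint_left.1 (hbXP _) hx1
        simp only [Finset.mem_union, not_or] at this hx
        rcases hx with hx | hx | hx
        exacts [this.1 (hA hx), this.2 hx, hx2 hx]) hc.ge
    refine ⟨V, by simpa using h3, h1, h2.trans ?_⟩
    have := hb (show A.card - (k + 1) ≤ A.card - k by omega)
    intro x hx
    have hx' := @this x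
    simp only [Finset.mem_union, Finset.mem_sdiff] at hx ⊢
    tauto
  choose! H hHs hHlo hHhi using hhigh
  let φ : Finset α → Finset α := fun A =>
    if A.card ≤ k then A ∪ ψ A else if A.card < m then H A else T
  have hφlow : ∀ A, A.card ≤ k → φ A = A ∪ ψ A := fun A h => if_pos h
  have hφmid : ∀ A, k < A.card → A.card < m → φ A = H A := fun A h h' => by
    simp [φ, h.not_ge, h']
  have hφtop : ∀ A, m ≤ A.card → φ A = T := fun A h => by
    simp [φ, h.not_gt, show ¬ A.card ≤ k by omega]
  have hφsub : ∀ A, A ⊆ X → A.card < m → φ A ⊆ A ∪ (P ∪ b (A.card - k)) := by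
    intro A hA hAm
    rcases le_or_gt A.card k with h | h
    · rw [hφlow A h]
      exact Finset.union_subset_union_right ((hψP A).trans Finset.subset_union_left)
    · rw [hφmid A h hAm]
      exact hHhi A hA h hAm
  have hφself : ∀ A, A ⊆ X → A ⊆ φ A := by
    intro A hA
    rcases le_or_gt A.card k with h | h
    · rw [hφlow A h]
      exact Finset.subset_union_left
    · rcases lt_or_ge A.card m with h' | h'
      · rw [hφmid A h h']
        exact Finset.subset_union_left.trans (hHlo A hA h h')
      · rw [hφtop A h']
        exact hA.trans hXT
  refine hblue (containsCube_of_trace hX φ (fun A B hAB hBX => ?_) (fun A hA => ?_) fun A hA => ?_)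
  · rcases hAB.eq_or_ssubset with rfl | hss
    · exact subset_rfl
    have hA := hAB.trans hBX
    have hlt := Finset.card_lt_card hss
    have hBm := Finset.card_le_card hBX
    rcases le_or_gt B.card k with hB | hB
    · rw [hφlow A (by omega), hφlow B hB]
      exact Finset.union_subset_union hAB (hψmono A B hAB)
    rcases lt_or_ge B.card m with hB' | hB'
    · rw [hφmid B hB hB']
      refine (hφsub A hA (by omega)).trans (subset_trans ?_ (hHlo B hBX hB hB'))
      exact Finset.union_subset_union hAB (Finset.union_subset_union_right (hb (by omega)))
    · rw [hφtop B hB']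
      exact (hφsub A hA (by omega)).trans
        (Finset.union_subset (hA.trans hXT) (Finset.union_subset hPT' (hbT _)))
  · have hAm := Finset.card_le_card hA
    rcases lt_or_ge A.card m with h | h
    · refine Finset.Subset.antisymm (fun x hx => ?_) (Finset.subset_inter (hφself A hA) hA)
      obtain ⟨hx1, hx2⟩ := Finset.mem_inter.1 hx
      have h3 := hφsub A hA h hx1
      simp only [Finset.mem_union] at h3
      rcases h3 with h3 | h3 | h3
      · exact h3
      · exact absurd h3 (Finset.disjoint_left.1 hXP hx2)
      · exact absurd (Finset.mem_union_left P hx2) (Finset.disjoint_left.1 (hbXP _) h3)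
    · rw [hφtop A h, Finset.inter_eq_right.2 hXT, Finset.eq_of_subset_of_card_le hA (by omega)]
  · rcases le_or_gt A.card k with h | h
    · rw [hφlow A h]
      exact hlow A hA h
    · rcases lt_or_ge A.card m with h' | h'
      · rw [hφmid A h h']
        exact hHs A hA h h'
      · rwa [hφtop A h']

end Cubes

lemma posetRamsey_le {m n k t N : ℕ} (hkm : k + 1 ≤ m)
    (h1 : m + n + 2 ^ k * t + n * (m - (k + 1)) ≤ N)
    (h2 : n + (2 ^ k - 1) * t + k + m * (n - t) ≤ N) :
    posetRamsey (Finset (Fin m)) (Finset (Fin n)) ≤ N := by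
  refine Nat.sInf_le fun c => ?_
  rcases containsCube_or_containsCube_compl {A | c A = true} hkm (by simpa using h1)
    (by simpa using h2) with ⟨e, he⟩ | ⟨e, he⟩
  · exact Or.inl ⟨e, he⟩
  · exact Or.inr ⟨e, fun q => by simpa using he q⟩

lemma posetRamsey_cube_le {m n k : ℕ} (hkm : k + 1 ≤ m) (hmn : m ≤ n) :
    posetRamsey (Finset (Fin m)) (Finset (Fin n)) ≤
      m + n + 2 ^ k * (n * (k + 1) / m) + n * (m - (k + 1)) := by
  set t := n * (k + 1) / m with ht
  have hm : 0 < m := by omega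
  have hkt : k + 1 ≤ t := (Nat.le_div_iff_mul_le hm).2 (by nlinarith)
  have htn : t ≤ n := Nat.div_le_of_le_mul (by nlinarith)
  have hmt : n * (k + 1) < m * t + m := by
    have := Nat.lt_div_mul_add hm (a := n * (k + 1))
    rwa [← ht, mul_comm t m] at this
  refine posetRamsey_le (t := t) hkm le_rfl ?_
  have hpow : 2 ^ k * t = (2 ^ k - 1) * t + t := by
    rw [Nat.sub_mul, one_mul, Nat.sub_add_cancel]
    exact Nat.le_mul_of_pos_left t (by positivity)
  rw [hpow, Nat.mul_sub, Nat.mul_sub, mul_comm n m]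
  have h3 : m * t ≤ m * n := Nat.mul_le_mul_left m htn
  have h4 : n * (k + 1) ≤ m * n := by nlinarith
  omega

lemma posetRamsey_cube_le_log {n m : ℕ} (hm : 0 < m) (hmn : m ≤ n)
    {ε : ℝ} (hε0 : 0 < ε) (hε1 : ε < 1)
    (h : ((n : ℝ) + (m : ℝ)) / (n : ℝ) * (1 / ((1 - ε) * Real.logb 2 (m : ℝ))) +
        (m : ℝ) ^ (-ε) ≤ ε) :
    (posetRamsey (Finset (Fin m)) (Finset (Fin n)) : ℝ) ≤
      (n : ℝ) * ((m : ℝ) - (1 - ε) ^ 2 * Real.logb 2 (m : ℝ)) := by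
  have hm2 : 1 < m := by
    rcases Nat.lt_or_ge 1 m with h' | h'
    · exact h'
    · obtain rfl : m = 1 := by omega
      norm_num at h
      linarith
  have hmR : (0 : ℝ) < m := by exact_mod_cast hm
  have hnR : (0 : ℝ) < n := by exact_mod_cast hm.trans_le hmn
  set L := Real.logb 2 (m : ℝ)
  have hL0 : 0 < L := Real.logb_pos one_lt_two (by exact_mod_cast hm2)
  set d := (1 - ε) * L with hd
  have hd0 : 0 < d := mul_pos (by linarith) hL0
  set k := ⌊d⌋₊
  have hkd : (k : ℝ) ≤ d := Nat.floor_le hd0.le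
  have hdk : d < k + 1 := Nat.lt_floor_add_one d
  have h2L : (2 : ℝ) ^ L = m := Real.rpow_logb two_pos (by norm_num) hmR
  have h2d : (2 : ℝ) ^ d = m * (m : ℝ) ^ (-ε) := by
    rw [hd, mul_comm, Real.rpow_mul zero_le_two, h2L, sub_eq_add_neg, Real.rpow_add hmR,
      Real.rpow_one]
  have h2k : (2 : ℝ) ^ k ≤ m * (m : ℝ) ^ (-ε) := by
    rw [← h2d, ← Real.rpow_natCast]
    exact Real.rpow_le_rpow_of_exponent_le one_le_two hkd
  have hw1 : (m : ℝ) ^ (-ε) < 1 :=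
    Real.rpow_lt_one_of_one_lt_of_neg (by exact_mod_cast hm2) (by linarith)
  set w := (m : ℝ) ^ (-ε)
  have hkm : k + 1 ≤ m := by
    have h3 : ((2 ^ k : ℕ) : ℝ) < m := by
      push_cast
      nlinarith
    have h4 : 2 ^ k < m := by exact_mod_cast h3
    exact Nat.lt_two_pow_self.trans h4
  have hbound := posetRamsey_cube_le hkm hmn
  have hboundR : (posetRamsey (Finset (Fin m)) (Finset (Fin n)) : ℝ) ≤
      m + n + 2 ^ k * (n * (k + 1) / m) + n * (m - (k + 1)) := by
    have h3 : (posetRamsey (Finset (Fin m)) (Finset (Fin n)) : ℝ) ≤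
        ((m + n + 2 ^ k * (n * (k + 1) / m) + n * (m - (k + 1)) : ℕ) : ℝ) := by
      exact_mod_cast hbound
    refine h3.trans ?_
    have h4 : ((n * (k + 1) / m : ℕ) : ℝ) ≤ n * (k + 1) / m := by
      have := Nat.cast_div_le (α := ℝ) (m := n * (k + 1)) (n := m)
      push_cast at this
      exact this
    push_cast [Nat.cast_sub hkm]
    gcongr
  have hcost : (2 : ℝ) ^ k * (n * (k + 1) / m) ≤ w * (n * (k + 1)) := by
    calc (2 : ℝ) ^ k * (n * (k + 1) / m) ≤ m * w * (n * (k + 1) / m) := by gcongr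
      _ = w * (n * (k + 1)) := by field_simp
  have hsave : (n : ℝ) + m ≤ n * d * (ε - w) := by
    have h3 : ((n : ℝ) + m) / n * (1 / d) ≤ ε - w := by linarith
    rw [div_mul_div_comm, mul_one, div_le_iff₀ (by positivity)] at h3
    linarith
  have hmain : n * d * (1 - w) ≤ n * (k + 1) * (1 - w) := by
    have : 0 ≤ 1 - w := by linarith
    gcongr
  have hgoal : (1 - ε) ^ 2 * L = (1 - ε) * d := by rw [hd]; ring
  rw [hgoal]
  nlinarith

lemma reciprocal_sqrt_log_admissible {n m : ℕ} (hm : 2 ^ 25 ≤ m) (hmn : m ≤ n) :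
    ((n : ℝ) + (m : ℝ)) / (n : ℝ) *
        (1 / ((1 - 1 / √(Real.logb 2 (m : ℝ))) * Real.logb 2 (m : ℝ))) +
      (m : ℝ) ^ (-(1 / √(Real.logb 2 (m : ℝ)))) ≤ 1 / √(Real.logb 2 (m : ℝ)) := by
  have hmR : (2 : ℝ) ^ (25 : ℕ) ≤ m := by exact_mod_cast hm
  have hm0 : (0 : ℝ) < m := lt_of_lt_of_le (by positivity) hmR
  have hmnR : (m : ℝ) ≤ n := by exact_mod_cast hmn
  set L := Real.logb 2 (m : ℝ) with hL
  have hL25 : 25 ≤ L := by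
    rw [hL, Real.le_logb_iff_rpow_le one_lt_two hm0]
    exact_mod_cast hm
  set r := √L with hr
  have hr5 : 5 ≤ r := Real.le_sqrt_of_sq_le (by linarith)
  have hrL : r * r = L := Real.mul_self_sqrt (by linarith)
  have h2L : (2 : ℝ) ^ L = m := Real.rpow_logb two_pos (by norm_num) hm0
  have hpow : (m : ℝ) ^ (-(1 / r)) = ((2 : ℝ) ^ r)⁻¹ := by
    rw [← h2L, ← Real.rpow_mul zero_le_two, ← Real.rpow_neg zero_le_two, ← hrL]
    congr 1
    field_simp
  have h2r : 2 * r ≤ (2 : ℝ) ^ r := by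
    have h3 := one_add_mul_self_le_rpow_one_add (s := 1) (by norm_num) (p := r - 1) (by linarith)
    have h4 : (2 : ℝ) ^ r = 2 * (1 + 1 : ℝ) ^ (r - 1) := by
      rw [Real.rpow_sub_one (by norm_num)]
      norm_num
      ring
    rw [h4]
    linarith
  have h1 : ((n : ℝ) + m) / n ≤ 2 := by
    rw [div_le_iff₀ (by linarith)]
    linarith
  have h5 : (1 - 1 / r) * L = r * (r - 1) := by
    rw [← hrL]
    field_simp
  have h6 : 1 / (r * (r - 1)) ≤ 1 / (4 * r) :=
    one_div_le_one_div_of_le (by positivity) (by nlinarith)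
  have h7 : ((2 : ℝ) ^ r)⁻¹ ≤ 1 / (2 * r) := by
    rw [← one_div]
    exact one_div_le_one_div_of_le (by positivity) h2r
  have h8 : (0 : ℝ) ≤ 1 / (r * (r - 1)) := one_div_nonneg.2 (by nlinarith)
  rw [hpow, h5]
  calc ((n : ℝ) + m) / n * (1 / (r * (r - 1))) + ((2 : ℝ) ^ r)⁻¹
      ≤ 2 * (1 / (4 * r)) + 1 / (2 * r) := by gcongr
    _ = 1 / r := by field_simp; norm_num

/-- Let `n ≥ m ≥ 1` and `0 < ε < 1` with
`((n+m)/n)·(1/((1−ε)·log m)) + m^{−ε} ≤ ε` (log base 2). Then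
`R(Q_m, Q_n) ≤ n·(m − (1−ε)²·log m)`. In particular, for all `2^25 ≤ m ≤ n`,
`R(Q_m, Q_n) ≤ n·(m − (1 − 2/√(log m))·log m)`. -/
theorem offdiagonal_ramsey_upper (n m : ℕ) (hm : 0 < m) (hmn : m ≤ n)
    (ε : ℝ) (hε0 : 0 < ε) (hε1 : ε < 1)
    (h : ((n : ℝ) + (m : ℝ)) / (n : ℝ) * (1 / ((1 - ε) * Real.logb 2 (m : ℝ))) +
        (m : ℝ) ^ (-ε) ≤ ε) :
    (posetRamsey (Finset (Fin m)) (Finset (Fin n)) : ℝ) ≤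
      (n : ℝ) * ((m : ℝ) - (1 - ε) ^ 2 * Real.logb 2 (m : ℝ)) ∧
    (∀ m' n' : ℕ, 2 ^ 25 ≤ m' → m' ≤ n' →
      (posetRamsey (Finset (Fin m')) (Finset (Fin n')) : ℝ) ≤
        (n' : ℝ) * ((m' : ℝ) -
          (1 - 2 / Real.sqrt (Real.logb 2 (m' : ℝ))) * Real.logb 2 (m' : ℝ))) := by
  refine ⟨posetRamsey_cube_le_log hm hmn hε0 hε1 h, fun m' n' hm' hmn' => ?_⟩
  have hmR : (2 : ℝ) ^ (25 : ℕ) ≤ m' := by exact_mod_cast hm'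
  have hm0 : (0 : ℝ) < m' := lt_of_lt_of_le (by positivity) hmR
  have hL25 : 25 ≤ Real.logb 2 (m' : ℝ) := by
    rw [Real.le_logb_iff_rpow_le one_lt_two hm0]
    exact_mod_cast hm'
  have hr5 : 5 ≤ √(Real.logb 2 (m' : ℝ)) := Real.le_sqrt_of_sq_le (by linarith)
  have hr1 : 1 / √(Real.logb 2 (m' : ℝ)) < 1 := by
    rw [div_lt_one (by linarith)]
    linarith
  refine (posetRamsey_cube_le_log (by exact_mod_cast hm0) hmn' (by positivity) hr1
    (reciprocal_sqrt_log_admissible hm' hmn')).trans ?_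
  gcongr
  have := sq_nonneg (1 / √(Real.logb 2 (m' : ℝ)))
  rw [show 2 / √(Real.logb 2 (m' : ℝ)) = 2 * (1 / √(Real.logb 2 (m' : ℝ))) by ring]
  linarith
end

section
/- For every positive integer n, N*(n) + 1 ≤ R(V_n, V_n) ≤ N*(n) + 3, where for N ≥ α(n) one sets β(N,n) = min{β ∈ ℕ : binomial(N, β) ≥ n} and N*(n) = max{N ≥ α(n) : N − β(N,n) < α(n)}. -/
open Finset

/-- The complete multipartite poset `K_{t 0, …, t (ℓ-1)}`: pairwise disjoint antichains
`A^0, …, A^{ℓ-1}` with `|A^i| = t i`, where an element of `A^i` is strictly below an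
element of `A^j` iff `i < j`. -/
def Multipartite (ℓ : ℕ) (t : Fin ℓ → ℕ) : Type := Σ i : Fin ℓ, Fin (t i)

instance (ℓ : ℕ) (t : Fin ℓ → ℕ) : PartialOrder (Multipartite ℓ t) where
  le x y := x.1 < y.1 ∨ x = y
  le_refl x := Or.inr rfl
  le_trans x y z h₁ h₂ := by
    rcases h₁ with h₁ | rfl
    · rcases h₂ with h₂ | rfl
      · exact Or.inl (h₁.trans h₂)
      · exact Or.inl h₁
    · exact h₂
  le_antisymm x y h₁ h₂ := by
    rcases h₁ with h₁ | rfl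
    · rcases h₂ with h₂ | rfl
      · exact absurd (h₁.trans h₂) (lt_irrefl _)
      · rfl
    · rfl

/-- The Sperner number `α(m)`: the least `N` such that the Boolean lattice `Q_N` contains
an antichain of size `m`. -/
noncomputable def sperner (m : ℕ) : ℕ :=
  sInf {N : ℕ | ∃ S : Finset (Finset (Fin N)), S.card = m ∧
    IsAntichain (· ≤ ·) (S : Set (Finset (Fin N)))}

/-- `β(N,n)`: the least `β` with `C(N, β) ≥ n`. -/
noncomputable def betaF (N n : ℕ) : ℕ := sInf {β : ℕ | n ≤ N.choose β}

/-- `N*(n)`: the largest `N ≥ α(n)` with `N − β(N,n) < α(n)`. -/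
noncomputable def Nstar (n : ℕ) : ℕ :=
  sSup {N : ℕ | sperner n ≤ N ∧ N - betaF N n < sperner n}

/-- An induced copy of the fork inside a colour class amounts to an element of the class together
with an antichain of size `n` in the class strictly above it. -/
lemma exists_fork_iff {N n : ℕ} {c : Finset (Fin N) → Bool} {b : Bool} :
    (∃ e : Multipartite 2 ![1, n] ↪o Finset (Fin N), ∀ p, c (e p) = b) ↔
      ∃ X, c X = b ∧ ∃ S : Finset (Finset (Fin N)), S.card = n ∧
        IsAntichain (· ≤ ·) (S : Set (Finset (Fin N))) ∧ ∀ Y ∈ S, X < Y ∧ c Y = b := by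
  constructor
  · rintro ⟨e, he⟩
    let bot : Multipartite 2 ![1, n] := ⟨0, (0 : Fin 1)⟩
    let top : Fin n → Multipartite 2 ![1, n] := fun i => ⟨1, i⟩
    have top_inj : Function.Injective top := fun i j h => by
      simpa [top] using eq_of_heq (Sigma.mk.inj h).2
    refine ⟨e bot, he _, univ.image (e ∘ top), ?_, ?_, ?_⟩
    · rw [card_image_of_injective _ (e.injective.comp top_inj), card_univ, Fintype.card_fin]
    · intro A hA B hB hne hle
      simp only [coe_image, coe_univ, Set.image_univ, Set.mem_range, Function.comp] at hA hB
      obtain ⟨i, rfl⟩ := hA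
      obtain ⟨j, rfl⟩ := hB
      rcases e.le_iff_le.mp hle with h | h
      · exact absurd h (lt_irrefl (1 : Fin 2))
      · exact hne (congrArg e h)
    · intro Y hY
      simp only [mem_image, mem_univ, true_and, Function.comp] at hY
      obtain ⟨i, rfl⟩ := hY
      refine ⟨e.lt_iff_lt.mpr (lt_of_le_of_ne (Or.inl (Fin.zero_lt_one)) ?_), he _⟩
      intro h
      exact absurd (congrArg Sigma.fst h) (Fin.zero_ne_one)
  · rintro ⟨X, hX, S, rfl, hS, hXS⟩
    let f : Multipartite 2 ![1, S.card] → Finset (Fin N) := fun p =>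
      match p with
      | ⟨0, _⟩ => X
      | ⟨1, i⟩ => (S.equivFin.symm i : Finset (Fin N))
    have hmem : ∀ i : Fin S.card, (S.equivFin.symm i : Finset (Fin N)) ∈ S :=
      fun i => (S.equivFin.symm i).2
    have hf : ∀ p q, f p ≤ f q ↔ p ≤ q := by
      rintro ⟨i, x⟩ ⟨j, y⟩
      match i, j, x, y with
      | 0, 0, x, y =>
        have : x = y := Subsingleton.elim (α := Fin 1) x y
        subst this
        exact iff_of_true le_rfl le_rfl
      | 0, 1, x, y => exact iff_of_true (hXS _ (hmem y)).1.le (Or.inl Fin.zero_lt_one)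
      | 1, 0, x, y =>
        refine iff_of_false (hXS _ (hmem x)).1.not_ge ?_
        rintro (h | h)
        · exact absurd h (by simp)
        · exact absurd (congrArg Sigma.fst h) Fin.zero_ne_one.symm
      | 1, 1, x, y =>
        constructor
        · intro h
          have := hS.eq (hmem x) (hmem y) h
          have : x = y := S.equivFin.symm.injective (Subtype.ext this)
          exact Or.inr (by rw [this])
        · rintro (h | h)
          · exact absurd h (lt_irrefl (1 : Fin 2))
          · exact (congrArg f h).le
    refine ⟨OrderEmbedding.ofMapLEIff f hf, ?_⟩
    rintro ⟨i, x⟩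
    match i, x with
    | 0, _ => exact hX
    | 1, x => exact (hXS _ (hmem x)).2

lemma choose_half_mono {k l : ℕ} (h : k ≤ l) : k.choose (k / 2) ≤ l.choose (l / 2) :=
  (Nat.choose_le_choose _ h).trans (Nat.choose_le_middle _ _)

lemma isAntichain_of_card_eq {α : Type*} {S : Finset (Finset α)} {r : ℕ}
    (h : ∀ Y ∈ S, Y.card = r) : IsAntichain (· ≤ ·) (S : Set (Finset α)) := by
  intro A hA B hB hne hle
  exact hne (eq_of_subset_of_card_le hle (by rw [h A hA, h B hB]))

lemma sperner_le_iff {n k : ℕ} : sperner n ≤ k ↔ n ≤ k.choose (k / 2) := by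
  have of_choose : ∀ {k}, n ≤ k.choose (k / 2) → k ∈ {N : ℕ | ∃ S : Finset (Finset (Fin N)),
      S.card = n ∧ IsAntichain (· ≤ ·) (S : Set (Finset (Fin N)))} := by
    intro k h
    obtain ⟨S, hS, hcard⟩ := exists_subset_card_eq
      (s := powersetCard (k / 2) (univ : Finset (Fin k))) (n := n) (by simpa using h)
    exact ⟨S, hcard, isAntichain_of_card_eq fun Y hY => (mem_powersetCard.mp (hS hY)).2⟩
  refine ⟨fun h => ?_, fun h => Nat.sInf_le (of_choose h)⟩
  have hne : n ≤ n.choose (n / 2) := by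
    simpa using Nat.choose_le_middle 1 n
  obtain ⟨S, hcard, hS⟩ := Nat.sInf_mem ⟨n, of_choose hne⟩
  have := IsAntichain.sperner hS
  rw [hcard, Fintype.card_fin] at this
  exact this.trans (choose_half_mono h)

/-- Sperner's theorem for antichains in the up-set of `X`. -/
lemma card_le_choose_of_antichain_above {N : ℕ} {X : Finset (Fin N)}
    {S : Finset (Finset (Fin N))} (hS : IsAntichain (· ≤ ·) (S : Set (Finset (Fin N))))
    (hX : ∀ Y ∈ S, X ≤ Y) : S.card ≤ (N - X.card).choose ((N - X.card) / 2) := by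
  let g : Finset (Fin N) → Finset {x // x ∉ X} := fun Y => Y.subtype (· ∉ X)
  have hg : ∀ A ∈ S, ∀ B ∈ S, g A ⊆ g B → A = B := by
    intro A hA B hB h
    refine hS.eq hA hB fun x hx => ?_
    by_cases hxX : x ∈ X
    · exact hX B hB hxX
    · have : (⟨x, hxX⟩ : {x // x ∉ X}) ∈ g B := h (by simpa [g] using hx)
      simpa [g] using this
  have hinj : Set.InjOn g S := fun A hA B hB h => hg A hA B hB h.subset
  have hanti : IsAntichain (· ⊆ ·) (S.image g : Set (Finset {x // x ∉ X})) := by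
    intro A hA B hB hne hle
    obtain ⟨A', hA', rfl⟩ := mem_image.mp hA
    obtain ⟨B', hB', rfl⟩ := mem_image.mp hB
    exact hne (congrArg g (hg A' hA' B' hB' hle))
  have h := hanti.sperner
  rw [card_image_of_injOn hinj] at h
  simpa using h

/-- By the LYM inequality, an antichain confined to layers of size below `n` has size below `n`. -/
lemma card_lt_of_forall_choose_lt {N n : ℕ} (hn : 0 < n) {S : Finset (Finset (Fin N))}
    (hS : IsAntichain (· ≤ ·) (S : Set (Finset (Fin N))))
    (h : ∀ Y ∈ S, N.choose Y.card < n) : S.card < n := by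
  rcases S.eq_empty_or_nonempty with rfl | hne
  · simpa using hn
  have lym := lubell_yamamoto_meshalkin_inequality_sum_inv_choose (𝕜 := ℚ) hS
  have hn' : (0 : ℚ) < n := by exact_mod_cast hn
  have : ∑ _Y ∈ S, (n : ℚ)⁻¹ < ∑ Y ∈ S, ((Fintype.card (Fin N)).choose Y.card : ℚ)⁻¹ := by
    refine sum_lt_sum_of_nonempty hne fun Y hY => ?_
    rw [Fintype.card_fin]
    have hpos : 0 < N.choose Y.card :=
      Nat.choose_pos (by simpa using card_le_univ Y)
    exact inv_strictAnti₀ (by exact_mod_cast hpos) (by exact_mod_cast h Y hY)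
  rw [sum_const, nsmul_eq_mul, ← div_eq_mul_inv] at this
  have := (div_lt_one hn').mp (this.trans_le lym)
  exact_mod_cast this

lemma le_choose_betaF {N n : ℕ} (h : sperner n ≤ N) : n ≤ N.choose (betaF N n) :=
  Nat.sInf_mem (s := {β : ℕ | n ≤ N.choose β}) ⟨N / 2, sperner_le_iff.mp h⟩

lemma choose_lt_of_lt_betaF {N n k : ℕ} (h : k < betaF N n) : N.choose k < n :=
  not_le.mp (Nat.notMem_of_lt_sInf (s := {β : ℕ | n ≤ N.choose β}) h)

lemma betaF_pos {N n : ℕ} (hn : 1 < n) (h : sperner n ≤ N) : 0 < betaF N n := by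
  by_contra h0
  have := le_choose_betaF h
  rw [Nat.eq_zero_of_not_pos h0, Nat.choose_zero_right] at this
  omega

lemma sperner_pos {n : ℕ} (hn : 1 < n) : 0 < sperner n := by
  by_contra h0
  have := sperner_le_iff.mp (not_lt.mp h0)
  norm_num at this
  omega

lemma sperner_one : sperner 1 = 0 :=
  Nat.le_zero.mp (sperner_le_iff.mpr (by norm_num))

lemma lt_two_mul_sperner {N n : ℕ} (h : N - betaF N n < sperner n) : N < 2 * sperner n := by
  by_contra! hN
  have : betaF N n ≤ sperner n / 2 := Nat.sInf_le <|
    (sperner_le_iff.mp le_rfl).trans (Nat.choose_le_choose _ (by omega))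
  omega

lemma bddAbove_Nstar (n : ℕ) :
    BddAbove {N : ℕ | sperner n ≤ N ∧ N - betaF N n < sperner n} :=
  ⟨2 * sperner n, fun _ hN => (lt_two_mul_sperner hN.2).le⟩

lemma Nstar_mem {n : ℕ} (hn : 1 < n) :
    sperner n ≤ Nstar n ∧ Nstar n - betaF (Nstar n) n < sperner n := by
  refine Nat.sSup_mem (s := {N : ℕ | sperner n ≤ N ∧ N - betaF N n < sperner n})
    ⟨sperner n, le_rfl, ?_⟩ (bddAbove_Nstar n)
  have := betaF_pos hn le_rfl
  have := sperner_pos hn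
  omega

lemma Nstar_one : Nstar 1 = 0 := by
  simp [Nstar, sperner_one]

/-- `Q_N` is Ramsey for the `n`-fork: every 2-coloring has a monochromatic copy. -/
def IsForkRamsey (n N : ℕ) : Prop :=
  ∀ c : Finset (Fin N) → Bool,
    (∃ e : Multipartite 2 ![1, n] ↪o Finset (Fin N), ∀ p, c (e p) = true) ∨
    (∃ e : Multipartite 2 ![1, n] ↪o Finset (Fin N), ∀ q, c (e q) = false)

lemma IsForkRamsey.mono {n M N : ℕ} (h : IsForkRamsey n M) (hMN : M ≤ N) : IsForkRamsey n N := by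
  intro c
  let φ : Finset (Fin M) ↪o Finset (Fin N) := mapEmbedding (Fin.castLEEmb hMN)
  exact (h (c ∘ φ)).imp (fun ⟨e, he⟩ => ⟨e.trans φ, he⟩) (fun ⟨e, he⟩ => ⟨e.trans φ, he⟩)

/-- Coloring the layers below `β(N,n)` blue and the others red avoids monochromatic forks. -/
lemma not_isForkRamsey {n N : ℕ} (hn : 0 < n) (h : N - betaF N n < sperner n) :
    ¬ IsForkRamsey n N := by
  intro H
  obtain ⟨c, hc⟩ : ∃ c : Finset (Fin N) → Bool, ∀ Y, c Y = decide (Y.card < betaF N n) :=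
    ⟨_, fun _ => rfl⟩
  rcases H c with H | H
  · obtain ⟨X, -, S, hcard, hS, hXS⟩ := exists_fork_iff.mp H
    refine (card_lt_of_forall_choose_lt hn hS fun Y hY => ?_).ne hcard
    exact choose_lt_of_lt_betaF (by simpa [hc] using (hXS Y hY).2)
  · obtain ⟨X, hX, S, hcard, hS, hXS⟩ := exists_fork_iff.mp H
    have hX : betaF N n ≤ X.card := by simpa [hc] using hX
    have := card_le_choose_of_antichain_above hS fun Y hY => (hXS Y hY).1.le
    rw [hcard] at this
    have := sperner_le_iff.mpr this
    omega

lemma two_mul_le_choose {n k : ℕ} (h : sperner n + 2 ≤ k) :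
    2 * n ≤ k.choose (sperner n / 2 + 1) := by
  refine le_trans ?_ (Nat.choose_le_choose _ h)
  have hle : n ≤ (sperner n).choose (sperner n / 2) := sperner_le_iff.mp le_rfl
  rw [Nat.choose_succ_succ', Nat.choose_succ_succ' (sperner n) (sperner n / 2)]
  have := Nat.choose_le_choose (sperner n / 2) (Nat.le_succ (sperner n))
  rw [Nat.succ_eq_add_one] at this
  omega

/-- The sets of size `|X| + r` above `X`. -/
lemma exists_layer_above {N : ℕ} (X : Finset (Fin N)) (r : ℕ) :
    ∃ T : Finset (Finset (Fin N)), T.card = (N - X.card).choose r ∧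
      ∀ Y ∈ T, X ⊆ Y ∧ Y.card = X.card + r := by
  have hdisj : ∀ Z ∈ powersetCard r Xᶜ, Disjoint X Z := fun Z hZ =>
    disjoint_compl_right.mono_right (mem_powersetCard.mp hZ).1
  refine ⟨(powersetCard r Xᶜ).image (X ∪ ·), ?_, ?_⟩
  · rw [card_image_of_injOn, card_powersetCard, card_compl, Fintype.card_fin]
    intro A hA B hB hAB
    have := congrArg (· \ X) hAB
    simpa [union_sdiff_cancel_left (hdisj A hA), union_sdiff_cancel_left (hdisj B hB)] using this
  · intro Y hY
    obtain ⟨Z, hZ, rfl⟩ := mem_image.mp hY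
    exact ⟨subset_union_left,
      by rw [card_union_of_disjoint (hdisj Z hZ), (mem_powersetCard.mp hZ).2]⟩

lemma isForkRamsey_of_le {n N b : ℕ} (hb : 0 < b) (hchoose : n ≤ N.choose b)
    (hN : sperner n + 2 + b ≤ N) : IsForkRamsey n N := by
  intro c
  by_contra! hno
  obtain ⟨hblue, hred⟩ := hno
  have key : ∀ d, ¬ ∃ X, c X = d ∧ ∃ S : Finset (Finset (Fin N)), S.card = n ∧
      IsAntichain (· ≤ ·) (S : Set (Finset (Fin N))) ∧ ∀ Y ∈ S, X < Y ∧ c Y = d := by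
    intro d hd
    obtain ⟨e, he⟩ := exists_fork_iff.mpr hd
    cases d
    · exact (hred e).elim fun q hq => hq (he q)
    · exact (hblue e).elim fun q hq => hq (he q)
  /- In any family in a fixed layer, fewer than `n` members above a given set share its color. -/
  have few : ∀ (X : Finset (Fin N)) (T : Finset (Finset (Fin N))) (r : ℕ), X.card < r →
      (∀ Y ∈ T, X ⊆ Y ∧ Y.card = r) → (T.filter (c · = c X)).card < n := by
    intro X T r hr hT
    by_contra! hcard
    obtain ⟨S, hST, hS⟩ := exists_subset_card_eq hcard
    have hST' : ∀ Y ∈ S, Y ∈ T ∧ c Y = c X := fun Y hY => mem_filter.mp (hST hY)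
    refine key (c X) ⟨X, rfl, S, hS, isAntichain_of_card_eq fun Y hY => (hT Y (hST' Y hY).1).2,
      fun Y hY => ⟨?_, (hST' Y hY).2⟩⟩
    obtain ⟨hXY, hY'⟩ := hT Y (hST' Y hY).1
    exact hXY.ssubset_of_ne fun h => by rw [h] at hr; omega
  obtain ⟨X, hXb, hX⟩ : ∃ X : Finset (Fin N), X.card = b ∧ c X ≠ c ∅ := by
    by_contra! hall
    have := few ∅ (powersetCard b univ) b (by simpa using hb)
      fun Y hY => ⟨empty_subset Y, (mem_powersetCard.mp hY).2⟩
    rw [filter_true_of_mem fun Y hY => hall Y (mem_powersetCard.mp hY).2, card_powersetCard,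
      card_univ, Fintype.card_fin] at this
    omega
  obtain ⟨T, hTcard, hT⟩ := exists_layer_above X (sperner n / 2 + 1)
  have h₁ := few X T _ (by omega) hT
  have h₂ := few ∅ T (X.card + (sperner n / 2 + 1)) (by rw [card_empty]; omega)
    fun Y hY => ⟨empty_subset Y, (hT Y hY).2⟩
  have hsplit := card_filter_add_card_filter_not (s := T) (fun Y => c Y = c X)
  have hcongr : T.filter (fun Y => ¬ c Y = c X) = T.filter (fun Y => c Y = c ∅) := by
    refine filter_congr fun Y _ => ?_
    revert hX
    cases c Y <;> cases c X <;> cases c ∅ <;> simp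
  rw [hcongr] at hsplit
  have := two_mul_le_choose (n := n) (k := N - X.card) (by omega)
  omega

lemma isForkRamsey_Nstar_add_three {n : ℕ} (hn : 0 < n) : IsForkRamsey n (Nstar n + 3) := by
  obtain rfl | hn1 : n = 1 ∨ 1 < n := by omega
  · refine isForkRamsey_of_le one_pos ?_ ?_ <;> simp [Nstar_one, sperner_one]
  · have hle : sperner n ≤ Nstar n + 1 := (Nstar_mem hn1).1.trans (Nat.le_succ _)
    have hbig : sperner n ≤ Nstar n + 1 - betaF (Nstar n + 1) n := by
      by_contra! hlt
      exact absurd (le_csSup (bddAbove_Nstar n) ⟨hle, hlt⟩) (Nat.not_succ_le_self _)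
    refine isForkRamsey_of_le (betaF_pos hn1 hle)
      ((le_choose_betaF hle).trans (Nat.choose_le_choose _ (by omega))) ?_
    have := sperner_pos hn1
    omega

lemma not_isForkRamsey_Nstar {n : ℕ} (hn : 0 < n) : ¬ IsForkRamsey n (Nstar n) := by
  obtain rfl | hn1 : n = 1 ∨ 1 < n := by omega
  · intro H
    rw [Nstar_one] at H
    obtain ⟨c⟩ : Nonempty (Finset (Fin 0) → Bool) := inferInstance
    rcases H c with H | H <;>
    · obtain ⟨X, -, S, hcard, -, hXS⟩ := exists_fork_iff.mp H
      obtain ⟨Y, hY⟩ := card_pos.mp (hcard ▸ one_pos)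
      exact (hXS Y hY).1.ne (Subsingleton.elim _ _)
  · exact not_isForkRamsey hn (Nstar_mem hn1).2

/-- For every positive integer `n`,
`N*(n) + 1 ≤ R(V_n, V_n) ≤ N*(n) + 3`, where the fork is `V_n = K_{1,n}`. -/
theorem fork_diagonal_ramsey (n : ℕ) (hn : 0 < n) :
    Nstar n + 1 ≤ posetRamsey (Multipartite 2 ![1, n]) (Multipartite 2 ![1, n]) ∧
    posetRamsey (Multipartite 2 ![1, n]) (Multipartite 2 ![1, n]) ≤ Nstar n + 3 := by
  have hmem := isForkRamsey_Nstar_add_three hn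
  refine ⟨?_, Nat.sInf_le hmem⟩
  have hR : IsForkRamsey n (posetRamsey (Multipartite 2 ![1, n]) (Multipartite 2 ![1, n])) :=
    Nat.sInf_mem (s := {N | IsForkRamsey n N}) ⟨_, hmem⟩
  by_contra! hlt
  exact not_isForkRamsey_Nstar hn (hR.mono (by omega))
end

section
/- There exists n_0 such that for all integers n ≥ n_0, the weak poset Ramsey number satisfies R_w(Q_n, Q_n) ≤ 0.96·n². -/
open Finset


/-- The weak poset Ramsey number `R_w(P,Q)`: the least `N` such that every blue/red coloring
of the Boolean lattice `Q_N` (`true` = blue, `false` = red) contains a blue weak copy of `P`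
or a red weak copy of `Q`, where a weak copy is the image of an injective monotone map. -/
noncomputable def weakPosetRamsey (P : Type*) (Q : Type*)
    [PartialOrder P] [PartialOrder Q] : ℕ :=
  sInf {N : ℕ | ∀ c : Finset (Fin N) → Bool,
    (∃ f : P → Finset (Fin N), Function.Injective f ∧ Monotone f ∧ ∀ p, c (f p) = true) ∨
    (∃ f : Q → Finset (Fin N), Function.Injective f ∧ Monotone f ∧ ∀ q, c (f q) = false)}

/-- The coloring `c` has a weak copy of `Q_n` in color `col`. -/
def HasWeakCopy {α : Type*} (c : Finset α → Bool) (n : ℕ) (col : Bool) : Prop :=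
  ∃ f : Finset (Fin n) → Finset α,
    Function.Injective f ∧ Monotone f ∧ ∀ A, c (f A) = col

/-- The lowest `k` levels of `Q_n` embed in color `col` strictly below `S`, with every element
of a level below every element of each higher level. -/
def HasLowerLevels {α : Type*} (c : Finset α → Bool) (n k : ℕ) (col : Bool) (S : Finset α) :
    Prop :=
  ∃ f : Finset (Fin n) → Finset α,
    (∀ A, #A < k → c (f A) = col ∧ f A ⊂ S) ∧
    (∀ A B, #A < #B → #B < k → f A ⊆ f B) ∧
    (∀ A B, #A < k → #B < k → f A = f B → A = B)

lemma HasLowerLevels.zero {α : Type*} (c : Finset α → Bool) (n : ℕ) (col : Bool)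
    (S : Finset α) : HasLowerLevels c n 0 col S :=
  ⟨fun _ => ∅, by simp, by simp, by simp⟩

lemma HasLowerLevels.mono {α : Type*} {c : Finset α → Bool} {n k : ℕ} {col : Bool}
    {S T : Finset α} (h : HasLowerLevels c n k col S) (hST : S ⊆ T) :
    HasLowerLevels c n k col T := by
  obtain ⟨f, h1, h2, h3⟩ := h
  exact ⟨f, fun A hA => ⟨(h1 A hA).1, (h1 A hA).2.trans_subset hST⟩, h2, h3⟩

lemma exists_injOn_of_card_le {β γ : Type*} [Nonempty γ] {V : Finset β} {U : Finset γ}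
    (h : #V ≤ #U) : ∃ g : β → γ, (∀ x ∈ V, g x ∈ U) ∧ Set.InjOn g V := by
  classical
  obtain ⟨W, hW, hc⟩ := Finset.exists_subset_card_eq h
  let e := Finset.equivOfCardEq hc.symm
  refine ⟨fun x => if hx : x ∈ V then (e ⟨x, hx⟩ : γ) else Classical.arbitrary γ, ?_, ?_⟩
  · intro x hx
    simp only [hx, dif_pos]
    exact hW (e ⟨x, hx⟩).2
  · intro x hx y hy hxy
    have hx' : x ∈ V := hx
    have hy' : y ∈ V := hy
    simp only [hx', hy', dif_pos] at hxy
    simpa using e.injective (Subtype.ext hxy)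

/-- A next level can be added once there are enough elements of the right color above `S`. -/
lemma HasLowerLevels.succ {α : Type*} {c : Finset α → Bool} {n k : ℕ} {col : Bool}
    {S T : Finset α} (h : HasLowerLevels c n k col S) (hST : S ⊆ T) (U : Finset (Finset α))
    (hU : ∀ X ∈ U, c X = col ∧ S ⊆ X ∧ X ⊂ T) (hcard : n.choose k ≤ #U) :
    HasLowerLevels c n (k + 1) col T := by
  obtain ⟨f, h1, h2, h3⟩ := h
  have hV : #(powersetCard k (univ : Finset (Fin n))) ≤ #U := by simpa using hcard
  obtain ⟨g, hg, hinj⟩ := exists_injOn_of_card_le hV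
  simp only [mem_powersetCard, subset_univ, true_and] at hg
  have hg' : ∀ A : Finset (Fin n), #A = k → c (g A) = col ∧ S ⊆ g A ∧ g A ⊂ T :=
    fun A hA => hU _ (hg A hA)
  refine ⟨fun A => if #A < k then f A else g A, ?_, ?_, ?_⟩
  · intro A hA
    dsimp only
    split_ifs with hk
    · exact ⟨(h1 A hk).1, (h1 A hk).2.trans_subset hST⟩
    · have := hg' A (by omega)
      exact ⟨this.1, this.2.2⟩
  · intro A B hAB hB
    have hA : #A < k := by omega
    simp only [hA, if_true]
    split_ifs with hk
    · exact h2 A B hAB hk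
    · exact (h1 A hA).2.subset.trans (hg' B (by omega)).2.1
  · intro A B hA hB hAB
    dsimp only at hAB
    split_ifs at hAB with ha hb hb
    · exact h3 A B ha hb hAB
    · have := (h1 A ha).2
      rw [hAB] at this
      exact absurd (hg' B (by omega)).2.1 this.not_subset
    · have := (h1 B hb).2
      rw [← hAB] at this
      exact absurd (hg' A (by omega)).2.1 this.not_subset
    · exact hinj (by simp; omega) (by simp; omega) hAB

lemma choose_le_two_pow (n k : ℕ) : n.choose k ≤ 2 ^ (n / 11 + 1 + 4 * k) := by
  rcases lt_or_ge n k with h | h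
  · simp [Nat.choose_eq_zero_of_lt h]
  have h1 : 16 ^ (n - k) * n.choose k ≤ 17 ^ n := by
    have := add_pow (1 : ℕ) 16 n
    norm_num at this
    rw [this]
    exact single_le_sum (f := fun m => 16 ^ (n - m) * n.choose m) (fun _ _ => Nat.zero_le _)
      (mem_range.2 (by omega))
  have h2 : 17 ^ n ≤ 2 ^ (n / 11 + 1) * 16 ^ n := by
    have hr : n % 11 < 11 := Nat.mod_lt _ (by norm_num)
    have e : ∀ x : ℕ, x ^ n = (x ^ 11) ^ (n / 11) * x ^ (n % 11) := fun x => by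
      rw [← pow_mul, ← pow_add, Nat.div_add_mod]
    rw [e 17, e 16, pow_succ]
    have hs : (17 : ℕ) ^ (n % 11) ≤ 2 * 16 ^ (n % 11) := by
      interval_cases n % 11 <;> norm_num
    calc (17 ^ 11) ^ (n / 11) * 17 ^ (n % 11)
        ≤ (2 * 16 ^ 11) ^ (n / 11) * (2 * 16 ^ (n % 11)) := by
          gcongr
          norm_num
      _ = _ := by rw [mul_pow]; ring
  have h3 : (16 : ℕ) ^ (n - k) * 16 ^ k = 16 ^ n := by rw [← pow_add]; congr 1; omega
  have h4 : (2 : ℕ) ^ (n / 11 + 1 + 4 * k) = 2 ^ (n / 11 + 1) * 16 ^ k := by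
    rw [pow_add, pow_mul]; norm_num
  rw [h4]
  refine Nat.le_of_mul_le_mul_left (h1.trans (h2.trans_eq ?_))
    (show 0 < 16 ^ (n - k) by positivity)
  rw [← h3]; ring

/-- One block of new coordinates above `S` yields a further level in one of the two colors. -/
lemma HasLowerLevels.step {α : Type*} [DecidableEq α] {c : Finset α → Bool} {n i j K : ℕ}
    {S G : Finset α} (hSG : S ⊆ G) (hi : HasLowerLevels c n i true S)
    (hj : HasLowerLevels c n j false S) (hiK : i ≤ K) (hjK : j ≤ K)
    (hG : #S + (n / 11 + 3 + 4 * K) ≤ #G) :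
    ∃ T, T ⊆ G ∧ #T = #S + (n / 11 + 3 + 4 * K) ∧
      (HasLowerLevels c n (i + 1) true T ∧ HasLowerLevels c n j false T ∨
        HasLowerLevels c n i true T ∧ HasLowerLevels c n (j + 1) false T) := by
  have hcard : n / 11 + 3 + 4 * K ≤ #(G \ S) := by
    rw [card_sdiff_of_subset hSG]; omega
  obtain ⟨Y, hYG, hY⟩ := Finset.exists_subset_card_eq hcard
  have hdisj : Disjoint S Y := disjoint_of_subset_right hYG disjoint_sdiff
  have hYne : Y.Nonempty := card_pos.1 (by omega)
  obtain ⟨y, hy⟩ := hYne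
  have hyS : y ∉ S := fun h => (disjoint_left.1 hdisj h hy)
  have hST : S ⊆ S ∪ Y := subset_union_left
  set P := (Y.erase y).powerset.image (S ∪ ·) with hP
  have hPcard : #P = 2 ^ (n / 11 + 2 + 4 * K) := by
    rw [hP, card_image_of_injOn, card_powerset, card_erase_of_mem hy]
    · congr 1; omega
    · intro A hA B hB hAB
      have hA' : Disjoint S A := disjoint_of_subset_right
        ((mem_powerset.1 hA).trans (erase_subset _ _)) hdisj
      have hB' : Disjoint S B := disjoint_of_subset_right
        ((mem_powerset.1 hB).trans (erase_subset _ _)) hdisj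
      dsimp only at hAB
      rw [← union_sdiff_cancel_left hA', ← union_sdiff_cancel_left hB', hAB]
  have hPmem : ∀ X ∈ P, S ⊆ X ∧ X ⊂ S ∪ Y := by
    intro X hX
    obtain ⟨A, hA, rfl⟩ := mem_image.1 hX
    have hA := mem_powerset.1 hA
    refine ⟨subset_union_left, ?_⟩
    refine (ssubset_iff_of_subset
      (union_subset_union_right (hA.trans (erase_subset _ _)))).2
      ⟨y, mem_union_right _ hy, fun h => ?_⟩
    rcases mem_union.1 h with h | h
    · exact hyS h
    · simpa using hA h
  have hsplit := card_filter_add_card_filter_not (s := P) (fun X => c X = true)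
  have hpow : (2 : ℕ) ^ (n / 11 + 2 + 4 * K) = 2 * 2 ^ (n / 11 + 1 + 4 * K) := by
    rw [← pow_succ']; congr 1; omega
  have hch : ∀ k ≤ K, n.choose k ≤ 2 ^ (n / 11 + 1 + 4 * K) := fun k hk =>
    (choose_le_two_pow n k).trans (Nat.pow_le_pow_right (by norm_num) (by omega))
  refine ⟨S ∪ Y, union_subset hSG (hYG.trans sdiff_subset), ?_, ?_⟩
  · rw [card_union_of_disjoint hdisj, hY]
  have hor : 2 ^ (n / 11 + 1 + 4 * K) ≤ #(P.filter fun X => c X = true) ∨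
      2 ^ (n / 11 + 1 + 4 * K) ≤ #(P.filter fun X => ¬ c X = true) := by omega
  rcases hor with h | h
  · refine Or.inl ⟨hi.succ hST _ (fun X hX => ?_) ((hch i hiK).trans h), hj.mono hST⟩
    rw [mem_filter] at hX
    exact ⟨hX.2, hPmem X hX.1⟩
  · refine Or.inr ⟨hi.mono hST, hj.succ hST _ (fun X hX => ?_) ((hch j hjK).trans h)⟩
    rw [mem_filter] at hX
    exact ⟨by simpa using hX.2, hPmem X hX.1⟩

/-- Number of coordinates that suffice to find `i` and `j` lower levels in the two colors. -/
def levelCost (n a i j : ℕ) : ℕ :=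
  max i j * (n / 11 + 3) + 2 * max i j ^ 2 + min i j * (n / 11 + 3 + 4 * a)

lemma levelCost_le {n a i j : ℕ} (hi : i ≤ a) (hj : j ≤ a) :
    levelCost n a i j ≤ a * (n / 11 + 3) + 2 * a ^ 2 + a * (n / 11 + 3 + 4 * a) := by
  unfold levelCost
  have h1 : max i j ≤ a := max_le hi hj
  have h2 : min i j ≤ a := (min_le_left _ _).trans hi
  gcongr

lemma levelCost_comm (n a i j : ℕ) : levelCost n a i j = levelCost n a j i := by
  simp [levelCost, max_comm, min_comm]

lemma levelCost_succ {n a i j : ℕ} (hj : j < a) :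
    levelCost n a i j + (n / 11 + 3 + 4 * max i j) ≤ levelCost n a (i + 1) j := by
  unfold levelCost
  generalize n / 11 + 3 = E
  rcases le_or_gt j i with h | h
  · rw [max_eq_left h, max_eq_left (by omega), min_eq_right h, min_eq_right (by omega)]
    nlinarith
  · rw [max_eq_right h.le, max_eq_right (by omega : i + 1 ≤ j), min_eq_left h.le,
      min_eq_left (by omega : i + 1 ≤ j)]
    nlinarith

lemma exists_lowerLevels_of_state {α : Type*} [DecidableEq α] (c : Finset α → Bool) (n a : ℕ)
    (G : Finset α)
    (hG : a * (n / 11 + 3) + 2 * a ^ 2 + a * (n / 11 + 3 + 4 * a) ≤ #G) :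
    ∀ t i j : ℕ, ∀ S : Finset α, i + j + t = 2 * a → i ≤ a → j ≤ a → S ⊆ G →
      #S ≤ levelCost n a i j → HasLowerLevels c n i true S → HasLowerLevels c n j false S →
      ∃ i' j' S', i' ≤ a ∧ j' ≤ a ∧ (i' = a ∨ j' = a) ∧ S' ⊆ G ∧
        #S' ≤ levelCost n a i' j' ∧ HasLowerLevels c n i' true S' ∧
        HasLowerLevels c n j' false S' := by
  intro t
  induction t with
  | zero =>
    intro i j S ht hi hj hS hc h1 h2
    exact ⟨i, j, S, hi, hj, by omega, hS, hc, h1, h2⟩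
  | succ t ih =>
    intro i j S ht hi hj hS hc h1 h2
    by_cases hlead : i = a ∨ j = a
    · exact ⟨i, j, S, hi, hj, hlead, hS, hc, h1, h2⟩
    have hi' : i < a := by omega
    have hj' : j < a := by omega
    have hs1 := levelCost_succ (n := n) (i := i) hj'
    have hs2 := levelCost_succ (n := n) (i := j) hi'
    rw [levelCost_comm, levelCost_comm n a (j + 1), max_comm] at hs2
    have hle := levelCost_le (n := n) (a := a) (i := i + 1) (j := j) hi' hj
    obtain ⟨T, hT, hTc, h | h⟩ := HasLowerLevels.step hS h1 h2 (le_max_left i j)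
      (le_max_right i j) (by omega)
    · exact ih (i + 1) j T (by omega) hi' hj hT (by omega) h.1 h.2
    · exact ih i (j + 1) T (by omega) hi hj' hT (by omega) h.1 h.2

lemma exists_lowerLevels {α : Type*} [DecidableEq α] (c : Finset α → Bool) (n a : ℕ)
    (G : Finset α)
    (hG : a * (n / 11 + 3) + 2 * a ^ 2 + a * (n / 11 + 3 + 4 * a) ≤ #G) :
    ∃ (k : Bool → ℕ) (S : Finset α) (v : ℕ), v ≤ a ∧ (∃ col, k col = a ∧ k (!col) = v) ∧
      S ⊆ G ∧ #S ≤ a * (n / 11 + 3) + 2 * a ^ 2 + v * (n / 11 + 3 + 4 * a) ∧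
      ∀ col, HasLowerLevels c n (k col) col S := by
  obtain ⟨i, j, S, hi, hj, hij, hS, hc, h1, h2⟩ :=
    exists_lowerLevels_of_state c n a G hG (2 * a) 0 0 ∅ (by omega) (by omega) (by omega)
      (by simp) (by simp) (.zero ..) (.zero ..)
  refine ⟨fun col => if col then i else j, S, min i j, by omega, ?_, hS, ?_, ?_⟩
  · rcases hij with rfl | rfl
    · exact ⟨true, by simp, by simp [hj]⟩
    · exact ⟨false, by simp, by simp [hi]⟩
  · have hm : max i j = a := by omega
    rwa [levelCost, hm] at hc
  · rintro (_ | _)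
    · simpa using h2
    · simpa using h1

/-- The set consisting of `S`, a copy of `A`, the blocks with index below `#A - p`, and a copy
of `T` in the block with index `#A - p`. -/
def middleSet {α : Type*} [DecidableEq α] {n L : ℕ} (ι : Fin n ⊕ Fin L × Fin n ↪ α)
    (S : Finset α) (p : ℕ) (A T : Finset (Fin n)) : Finset α :=
  S ∪ (A.disjSum (univ.filter fun z : Fin L × Fin n =>
    z.1 + p < #A ∨ (z.1 + p = #A ∧ z.2 ∈ T))).map ι

section Middle

variable {α : Type*} [DecidableEq α] {n L : ℕ} {ι : Fin n ⊕ Fin L × Fin n ↪ α}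
  {S : Finset α} {p : ℕ}

lemma inl_mem_middleSet (hι : ∀ z, ι z ∉ S) {A T : Finset (Fin n)} {x : Fin n} :
    ι (.inl x) ∈ middleSet ι S p A T ↔ x ∈ A := by
  simp only [middleSet, mem_union, hι, false_or, mem_map', inl_mem_disjSum]

lemma inr_mem_middleSet (hι : ∀ z, ι z ∉ S) {A T : Finset (Fin n)} {z : Fin L × Fin n} :
    ι (.inr z) ∈ middleSet ι S p A T ↔ z.1 + p < #A ∨ (z.1 + p = #A ∧ z.2 ∈ T) := by
  simp only [middleSet, mem_union, hι, false_or, mem_map', inr_mem_disjSum, mem_filter,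
    mem_univ, true_and]

lemma middleSet_mono_right {A T T' : Finset (Fin n)} (h : T ⊆ T') :
    middleSet ι S p A T ⊆ middleSet ι S p A T' := by
  refine union_subset_union_right (map_subset_map.2 (disjSum_mono_right _ ?_))
  exact monotone_filter_right _ fun z _ hz => hz.imp_right fun h' => ⟨h'.1, h h'.2⟩

lemma middleSet_subset_of_ssubset {A B T T' : Finset (Fin n)} (h : A ⊂ B) :
    middleSet ι S p A T ⊆ middleSet ι S p B T' := by
  have hc := card_lt_card h
  refine union_subset_union_right (map_subset_map.2 (disjSum_mono h.subset ?_))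
  exact monotone_filter_right _ fun z _ hz => Or.inl (by omega)

/-- The middle levels of `Q_n` embed in a color unless the other color has a copy of `Q_n`. -/
lemma exists_middleSet_or_hasWeakCopy (c : Finset α → Bool) (col : Bool)
    (hι : ∀ z, ι z ∉ S) :
    HasWeakCopy c n (!col) ∨ ∃ T : Finset (Fin n) → Finset (Fin n),
      ∀ A, p ≤ #A → #A < p + L → c (middleSet ι S p A (T A)) = col := by
  by_cases h : ∀ A : Finset (Fin n), ∃ T, p ≤ #A → #A < p + L →
      c (middleSet ι S p A T) = col
  · exact Or.inr (Classical.skolem.1 h)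
  push Not at h
  obtain ⟨A, hA⟩ := h
  have hp := (hA ∅).1
  have hL := (hA ∅).2.1
  refine Or.inl ⟨fun T => middleSet ι S p A T, ?_, fun T T' => middleSet_mono_right,
    fun T => ?_⟩
  · intro T T' hTT
    ext x
    have key : ∀ T : Finset (Fin n),
        ι (.inr (⟨#A - p, by omega⟩, x)) ∈ middleSet ι S p A T ↔ x ∈ T := fun T => by
      rw [inr_mem_middleSet hι]
      simp only
      constructor
      · rintro (h | h)
        · omega
        · exact h.2
      · exact fun h => Or.inr ⟨by omega, h⟩
    dsimp only at hTT
    rw [← key, hTT, key]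
  · have := (hA T).2.2
    revert this
    cases c (middleSet ι S p A T) <;> cases col <;> simp

end Middle

/-- Lower levels below `S`, upper levels above the complement of `S'` and middle levels between
fit together to a copy of `Q_n`. -/
lemma hasWeakCopy_of_levels {α : Type*} [DecidableEq α] [Fintype α] (c : Finset α → Bool)
    {n p q L : ℕ} {col : Bool} {S S' : Finset α} (hSS : Disjoint S S')
    (hp : HasLowerLevels c n p col S) (hq : HasLowerLevels (fun X => c Xᶜ) n q col S')
    (hL : p + q + L = n + 1) (hcard : #S + #S' + (L + 1) * n ≤ Fintype.card α) :
    HasWeakCopy c n col ∨ HasWeakCopy c n (!col) := by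
  have hM : Fintype.card (Fin n ⊕ Fin L × Fin n) ≤ Fintype.card ((S ∪ S')ᶜ : Finset α) := by
    rw [Fintype.card_coe, card_compl, card_union_of_disjoint hSS]
    simp only [Fintype.card_sum, Fintype.card_prod, Fintype.card_fin]
    have : (L + 1) * n = n + L * n := by ring
    omega
  obtain ⟨ι₀⟩ := Function.Embedding.nonempty_of_card_le hM
  let ι : Fin n ⊕ Fin L × Fin n ↪ α := ι₀.trans (Function.Embedding.subtype _)
  have hι' : ∀ z, ι z ∉ S ∪ S' := fun z => mem_compl.1 (ι₀ z).2
  have hι : ∀ z, ι z ∉ S := fun z h => hι' z (mem_union_left _ h)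
  rcases exists_middleSet_or_hasWeakCopy (p := p) c col hι with h | ⟨T, hT⟩
  · exact Or.inr h
  refine Or.inl ?_
  obtain ⟨f, hf1, hf2, hf3⟩ := hp
  obtain ⟨g, hg1, hg2, hg3⟩ := hq
  set m : Finset (Fin n) → Finset α := fun A => middleSet ι S p A (T A) with hm
  have hmS : ∀ A, S ⊆ m A := fun A => subset_union_left
  have hmS' : ∀ A, m A ⊆ S'ᶜ := by
    intro A
    refine union_subset (fun x hx => mem_compl.2 (disjoint_left.1 hSS hx)) ?_
    intro x hx
    obtain ⟨z, -, rfl⟩ := mem_map.1 hx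
    exact mem_compl.2 fun h => hι' z (mem_union_right _ h)
  have hminj : ∀ A B, m A = m B → A = B := fun A B h => by
    ext x
    rw [← inl_mem_middleSet (p := p) (T := T A) hι, ← inl_mem_middleSet (p := p) (T := T B) hι]
    change _ ∈ m A ↔ _ ∈ m B
    rw [h]
  have hgS : ∀ A : Finset (Fin n), #Aᶜ < q → S'ᶜ ⊂ (g Aᶜ)ᶜ := fun A hA =>
    compl_ssubset_compl.2 (hg1 _ hA).2
  have hcc : ∀ A : Finset (Fin n), #Aᶜ = n - #A := fun A => by simp [card_compl]
  have hcn : ∀ A : Finset (Fin n), #A ≤ n := fun A => by simpa using card_le_univ A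
  set F : Finset (Fin n) → Finset α := fun A =>
    if #A < p then f A else if #Aᶜ < q then (g Aᶜ)ᶜ else m A with hF
  have hcases : ∀ A, (#A < p ∧ F A = f A ∧ F A ⊂ S) ∨
      (p + L ≤ #A ∧ #Aᶜ < q ∧ F A = (g Aᶜ)ᶜ ∧ S'ᶜ ⊂ F A) ∨
      (p ≤ #A ∧ #A < p + L ∧ F A = m A ∧ S ⊆ F A ∧ F A ⊆ S'ᶜ) := by
    intro A
    have h1 := hcc A
    have h2 := hcn A
    by_cases ha : #A < p
    · have : F A = f A := by simp only [hF, ha, if_true]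
      exact Or.inl ⟨ha, this, this ▸ (hf1 A ha).2⟩
    by_cases hb : #Aᶜ < q
    · have : F A = (g Aᶜ)ᶜ := by simp only [hF, ha, hb, if_true, if_false]
      exact Or.inr (Or.inl ⟨by omega, hb, this, this ▸ hgS A hb⟩)
    · have : F A = m A := by simp only [hF, ha, hb, if_false]
      exact Or.inr (Or.inr ⟨by omega, by omega, this, this ▸ hmS A, this ▸ hmS' A⟩)
  have hSc : S ⊆ S'ᶜ := fun x hx => mem_compl.2 (disjoint_left.1 hSS hx)
  refine ⟨F, ?_, ?_, ?_⟩
  · intro A B hAB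
    rcases hcases A with ⟨ha, ea, sa⟩ | ⟨ha, ha', ea, sa⟩ | ⟨ha, ha', ea, sa, sa'⟩ <;>
    rcases hcases B with ⟨hb, eb, sb⟩ | ⟨hb, hb', eb, sb⟩ | ⟨hb, hb', eb, sb, sb'⟩
    · exact hf3 A B ha hb (by rw [← ea, ← eb, hAB])
    · exact absurd ((hAB ▸ sa).subset.trans hSc) sb.not_subset
    · exact absurd (hAB ▸ sb) sa.not_subset
    · exact absurd ((hAB ▸ sb).subset.trans hSc) sa.not_subset
    · refine compl_injective (hg3 _ _ ha' hb' (compl_injective ?_))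
      rw [← ea, ← eb, hAB]
    · exact absurd (hAB ▸ sb') sa.not_subset
    · exact absurd (hAB ▸ sa) sb.not_subset
    · exact absurd (hAB ▸ sa') sb.not_subset
    · exact hminj A B (by rw [← ea, ← eb, hAB])
  · intro A B hAB
    rcases eq_or_ne A B with rfl | hne
    · exact le_rfl
    have hss : A ⊂ B := hAB.ssubset_of_ne hne
    have hlt := card_lt_card hss
    rcases hcases A with ⟨ha, ea, sa⟩ | ⟨ha, ha', ea, sa⟩ | ⟨ha, ha', ea, sa, sa'⟩ <;>
    rcases hcases B with ⟨hb, eb, sb⟩ | ⟨hb, hb', eb, sb⟩ | ⟨hb, hb', eb, sb, sb'⟩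
    · rw [ea, eb]
      exact hf2 A B hlt hb
    · exact (sa.subset.trans hSc).trans sb.subset
    · exact sa.subset.trans sb
    · omega
    · rw [ea, eb]
      exact compl_subset_compl.2 (hg2 _ _ (card_lt_card (compl_ssubset_compl.2 hss)) ha')
    · omega
    · omega
    · exact sa'.trans sb.subset
    · rw [ea, eb]
      exact middleSet_subset_of_ssubset hss
  · intro A
    rcases hcases A with ⟨ha, ea, -⟩ | ⟨ha, ha', ea, -⟩ | ⟨ha, ha', ea, -, -⟩
    · rw [ea]
      exact (hf1 A ha).1
    · rw [ea]
      exact (hg1 _ ha').1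
    · rw [ea]
      exact hT A ha ha'

/-- If both colors have bottom and top levels, one lead of `a` levels on each side, then some
color has at least `a` plus the larger of the two trailing counts. -/
lemma exists_add_le_of_leads {a v w : ℕ} {k l : Bool → ℕ} (hv : v ≤ a) (hw : w ≤ a)
    (hk : ∃ col, k col = a ∧ k (!col) = v) (hl : ∃ col, l col = a ∧ l (!col) = w) :
    ∃ col, a + max v w ≤ k col + l col ∧ k col ≤ a ∧ l col ≤ a := by
  obtain ⟨x, hx, hx'⟩ := hk
  obtain ⟨y, hy, hy'⟩ := hl
  rcases Bool.eq_or_eq_not y x with rfl | rfl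
  · exact ⟨y, by omega, by omega, by omega⟩
  · rw [Bool.not_not] at hy'
    rcases le_total v w with h | h
    · exact ⟨x, by omega, by omega, by omega⟩
    · exact ⟨!x, by omega, by omega, by omega⟩

lemma hasWeakCopy_of_large {n N : ℕ} (hn : 2000 ≤ n) (hN : 24 * n ^ 2 < 25 * (N + 1))
    (c : Finset (Fin N) → Bool) : ∃ col, HasWeakCopy c n col := by
  obtain ⟨a, ha⟩ : ∃ a, a = n / 10 := ⟨_, rfl⟩
  have ha1 : 10 * a ≤ n := by omega
  have ha2 : n < 10 * a + 10 := by omega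
  obtain ⟨E, hE⟩ : ∃ E, E = n / 11 + 3 := ⟨_, rfl⟩
  have hE1 : 11 * E ≤ n + 33 := by omega
  have hgcard : 2 * (a * E + 2 * a ^ 2 + a * (E + 4 * a)) ≤ N := by
    nlinarith
  rw [hE] at hgcard
  obtain ⟨G, hG⟩ : ∃ G : Finset (Fin N),
      #G = a * (n / 11 + 3) + 2 * a ^ 2 + a * (n / 11 + 3 + 4 * a) := by
    obtain ⟨G, -, hG⟩ := Finset.exists_subset_card_eq (s := (univ : Finset (Fin N)))
      (n := a * (n / 11 + 3) + 2 * a ^ 2 + a * (n / 11 + 3 + 4 * a)) (by simp; omega)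
    exact ⟨G, hG⟩
  obtain ⟨k, S, v, hv, hk, hSG, hS, hkS⟩ := exists_lowerLevels c n a G hG.ge
  obtain ⟨l, S', w, hw, hl, hSG', hS', hlS⟩ :=
    exists_lowerLevels (fun X => c Xᶜ) n a Gᶜ (by
      rw [card_compl, hG, Fintype.card_fin]; omega)
  have hdisj : Disjoint S S' := disjoint_of_subset_left hSG
    (disjoint_of_subset_right hSG' disjoint_compl_right)
  obtain ⟨col, hcol, hka, hla⟩ := exists_add_le_of_leads hv hw hk hl
  obtain ⟨L, hL⟩ : ∃ L, k col + l col + L = n + 1 := ⟨n + 1 - (k col + l col), by omega⟩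
  have hcard : #S + #S' + (L + 1) * n ≤ Fintype.card (Fin N) := by
    rw [Fintype.card_fin]
    rw [← hE] at hS hS'
    obtain ⟨m, hm⟩ : ∃ m, m = max v w := ⟨_, rfl⟩
    have hL' : L + 1 + a + m ≤ n + 2 := by omega
    have h1 : (L + 1 + a + m) * n ≤ (n + 2) * n := Nat.mul_le_mul_right _ hL'
    have h2 : v * (E + 4 * a) ≤ m * (E + 4 * a) := Nat.mul_le_mul_right _ (by omega)
    have h3 : w * (E + 4 * a) ≤ m * (E + 4 * a) := Nat.mul_le_mul_right _ (by omega)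
    have h4 : m * (2 * (E + 4 * a)) ≤ m * n := Nat.mul_le_mul_left _ (by omega)
    have h5 : a * (11 * E) ≤ a * (n + 33) := Nat.mul_le_mul_left _ hE1
    have h6 : 25 * ((n + 2) * n + 2 * (a * E) + 4 * a ^ 2) ≤ 24 * n ^ 2 + 25 * (a * n) := by
      obtain ⟨r, hr⟩ : ∃ r, n = 10 * a + r := ⟨n - 10 * a, by omega⟩
      have hr9 : r ≤ 9 := by omega
      have ha200 : 200 * a ≤ a * a := Nat.mul_le_mul_right _ (by omega)
      have hr2 : r * r ≤ 9 * r := Nat.mul_le_mul_right _ hr9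
      rw [hr] at h5 ⊢
      nlinarith
    nlinarith
  rcases hasWeakCopy_of_levels c hdisj (hkS col) (hlS col) hL hcard with h | h
  · exact ⟨col, h⟩
  · exact ⟨!col, h⟩

/-- There is `n₀` such that for all `n ≥ n₀`, `R_w(Q_n, Q_n) ≤ 0.96·n²`. -/
theorem weak_diagonal_ramsey_upper :
    ∃ n₀ : ℕ, ∀ n : ℕ, n₀ ≤ n →
      (weakPosetRamsey (Finset (Fin n)) (Finset (Fin n)) : ℝ) ≤
        (0.96 : ℝ) * (n : ℝ) ^ 2 := by
  refine ⟨2000, fun n hn => ?_⟩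
  have hle : weakPosetRamsey (Finset (Fin n)) (Finset (Fin n)) ≤ 24 * n ^ 2 / 25 := by
    refine Nat.sInf_le fun c => ?_
    obtain ⟨col, h⟩ := hasWeakCopy_of_large hn (by omega) c
    cases col
    · exact Or.inr h
    · exact Or.inl h
  have h25 : 25 * weakPosetRamsey (Finset (Fin n)) (Finset (Fin n)) ≤ 24 * n ^ 2 := by omega
  have : (25 : ℝ) * weakPosetRamsey (Finset (Fin n)) (Finset (Fin n)) ≤ 24 * (n : ℝ) ^ 2 := by
    exact_mod_cast h25
  linarith
end
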